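/- Let (E, {f_i}_{i=1}^m) ∈ 𝓔 with convex hull I = [a,b]. Then the following statements are equivalent: (i) f_1(I) ∩ f_2(I) = ∅ and f_{m−1}(I) ∩ f_m(I) = ∅; (ii) for every integer k ≥ 1, if k = 2^s for some integer s ≥ 0 then dim_H U_k(E) = dim_H U_1(E), and otherwise U_k(E) = ∅; (iii) f_1(b) ∉ U_{ℵ₀}(E) and f_m(a) ∉ U_{ℵ₀}(E); (iv) U_{ℵ₀}(E) = ∅. -/

import Mathlib

open Set Filter MeasureTheory

/-- A self-similar iterated function system on `ℝ` given by `m` similitudes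
`f i x = r i * x + t i` (for `1 ≤ i ≤ m`, `m ≥ 3`), together with its attractor `E`:
the unique nonempty compact set with `E = ⋃_{i=1}^m f_i(E)`. -/
structure ClassE where
  m : ℕ
  r : ℕ → ℝ
  t : ℕ → ℝ
  E : Set ℝ
  hm : 3 ≤ m
  hr : ∀ i, 1 ≤ i → i ≤ m → 0 < r i ∧ r i < 1
  hEne : E.Nonempty
  hEcpt : IsCompact E
  hEinv : E = ⋃ i ∈ Finset.Icc 1 m, (fun x => r i * x + t i) '' E

namespace ClassE

/-- The `i`-th similitude. -/
def f (S : ClassE) (i : ℕ) (x : ℝ) : ℝ := S.r i * x + S.t i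

/-- Left endpoint `a` of the convex hull of `E`. -/
noncomputable def a (S : ClassE) : ℝ := sInf S.E

/-- Right endpoint `b` of the convex hull of `E`. -/
noncomputable def b (S : ClassE) : ℝ := sSup S.E

/-- The convex hull `I = [a, b]` of `E`. -/
noncomputable def I (S : ClassE) : Set ℝ := Set.Icc S.a S.b

/-- Condition (A): `a = f_1(a) < f_2(a) < ⋯ < f_m(a) < f_m(b) = b`. -/
def condA (S : ClassE) : Prop :=
  S.f 1 S.a = S.a ∧ (∀ i, 1 ≤ i → i < S.m → S.f i S.a < S.f (i + 1) S.a) ∧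
    S.f S.m S.a < S.f S.m S.b ∧ S.f S.m S.b = S.b

/-- Condition (B): `f_i(I) ∩ f_{i+2}(I) = ∅` for all `1 ≤ i ≤ m - 2`. -/
def condB (S : ClassE) : Prop :=
  ∀ i, 1 ≤ i → i + 2 ≤ S.m → S.f i '' S.I ∩ S.f (i + 2) '' S.I = ∅

/-- Condition (C): there are `i, j ∈ {1, …, m-1}` with `f_i(I) ∩ f_{i+1}(I) = ∅` and
`f_j(I) ∩ f_{j+1}(I) ≠ ∅`. -/
def condC (S : ClassE) : Prop :=
  (∃ i, 1 ≤ i ∧ i + 1 ≤ S.m ∧ S.f i '' S.I ∩ S.f (i + 1) '' S.I = ∅) ∧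
    (∃ j, 1 ≤ j ∧ j + 1 ≤ S.m ∧ S.f j '' S.I ∩ S.f (j + 1) '' S.I ≠ ∅)

/-- Condition (D): whenever `f_i(I) ∩ f_{i+1}(I) ≠ ∅` there are `u, v ≥ 1` with
`f_i(I) ∩ f_{i+1}(I) = f_i ∘ f_m^u (I) = f_{i+1} ∘ f_1^v (I)`. -/
def condD (S : ClassE) : Prop :=
  ∀ i, 1 ≤ i → i + 1 ≤ S.m → S.f i '' S.I ∩ S.f (i + 1) '' S.I ≠ ∅ →
    ∃ u v : ℕ, 1 ≤ u ∧ 1 ≤ v ∧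
      S.f i '' S.I ∩ S.f (i + 1) '' S.I = (S.f i ∘ (S.f S.m)^[u]) '' S.I ∧
      S.f i '' S.I ∩ S.f (i + 1) '' S.I = (S.f (i + 1) ∘ (S.f 1)^[v]) '' S.I

/-- Membership in the class `𝓔`: conditions (A)–(D). -/
def goodE (S : ClassE) : Prop := S.condA ∧ S.condB ∧ S.condC ∧ S.condD

/-- `prefixMap d n = f_{d 0} ∘ f_{d 1} ∘ ⋯ ∘ f_{d (n-1)}`. -/
def prefixMap (S : ClassE) (d : ℕ → ℕ) : ℕ → ℝ → ℝ
  | 0 => id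
  | n + 1 => S.prefixMap d n ∘ S.f (d n)

/-- `d : ℕ → ℕ` (with digits in `{1, …, m}`) is a coding of `x` if
`x = lim_n f_{d 0} ∘ ⋯ ∘ f_{d (n-1)} (0)`. -/
def isCoding (S : ClassE) (d : ℕ → ℕ) (x : ℝ) : Prop :=
  (∀ n, 1 ≤ d n ∧ d n ≤ S.m) ∧
    Tendsto (fun n => S.prefixMap d n 0) atTop (nhds x)

/-- The set of codings of `x`. -/
def codings (S : ClassE) (x : ℝ) : Set (ℕ → ℕ) := {d | S.isCoding d x}

/-- `U k E`: the set of points of `E` having exactly `k` distinct codings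
(`k` a cardinal; e.g. `k = ℵ₀` for countably infinitely many codings,
`k = 𝔠 = 2^ℵ₀` for a continuum of codings). -/
def U (S : ClassE) (k : Cardinal) : Set ℝ :=
  {x ∈ S.E | Cardinal.mk (S.codings x) = k}

end ClassE

open ClassE

namespace ClassE

def Vd (S : ClassE) (i : ℕ) : Prop := 1 ≤ i ∧ i ≤ S.m

def cns (i : ℕ) (d : ℕ → ℕ) : ℕ → ℕ
  | 0 => i
  | n + 1 => d n

theorem cns_inj (i : ℕ) : Function.Injective (cns i) := by
  intro c d h
  funext n
  exact congrFun h (n + 1)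

theorem cns_eta (d : ℕ → ℕ) : cns (d 0) (fun n => d (n + 1)) = d := by
  funext n
  cases n <;> rfl

theorem f_inj (S : ClassE) {i : ℕ} (hi : S.Vd i) : Function.Injective (S.f i) := by
  intro x y h
  have := (S.hr i hi.1 hi.2).1
  simp only [f] at h
  have h2 : S.r i * x = S.r i * y := by linarith
  exact mul_left_cancel₀ this.ne' h2

theorem fE (S : ClassE) {i : ℕ} (hi : S.Vd i) {x : ℝ} (hx : x ∈ S.E) : S.f i x ∈ S.E := by
  rw [S.hEinv]
  simp only [mem_iUnion]
  exact ⟨i, Finset.mem_Icc.2 hi, x, hx, rfl⟩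

theorem Epre (S : ClassE) {x : ℝ} (hx : x ∈ S.E) : ∃ i y, S.Vd i ∧ y ∈ S.E ∧ S.f i y = x := by
  rw [S.hEinv] at hx
  simp only [mem_iUnion] at hx
  obtain ⟨i, hi, y, hy, h⟩ := hx
  exact ⟨i, y, Finset.mem_Icc.1 hi, hy, h⟩

theorem aE (S : ClassE) : S.a ∈ S.E := S.hEcpt.sInf_mem S.hEne
theorem bE (S : ClassE) : S.b ∈ S.E := S.hEcpt.sSup_mem S.hEne
theorem EI (S : ClassE) {x : ℝ} (hx : x ∈ S.E) : x ∈ S.I :=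
  ⟨csInf_le S.hEcpt.bddBelow hx, le_csSup S.hEcpt.bddAbove hx⟩

theorem fI (S : ClassE) {i : ℕ} (hi : S.Vd i) {x : ℝ} (hx : x ∈ S.I) : S.f i x ∈ S.I := by
  have h1 := S.EI (S.fE hi S.aE)
  have h2 := S.EI (S.fE hi S.bE)
  have h3 := (S.hr i hi.1 hi.2).1
  have h4 := mul_le_mul_of_nonneg_left hx.1 h3.le
  have h5 := mul_le_mul_of_nonneg_left hx.2 h3.le
  simp only [I, f, mem_Icc] at *
  constructor <;> linarith

theorem iterI (S : ClassE) {i : ℕ} (hi : S.Vd i) {x : ℝ} (hx : x ∈ S.I) (n : ℕ) :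
    (S.f i)^[n] x ∈ S.I := by
  induction n with
  | zero => exact hx
  | succ n ih => rw [Function.iterate_succ_apply']; exact S.fI hi ih

theorem iterE (S : ClassE) {i : ℕ} (hi : S.Vd i) {x : ℝ} (hx : x ∈ S.E) (n : ℕ) :
    (S.f i)^[n] x ∈ S.E := by
  induction n with
  | zero => exact hx
  | succ n ih => rw [Function.iterate_succ_apply']; exact S.fE hi ih

theorem iter_mem (S : ClassE) {i : ℕ} (hi : S.Vd i) {x : ℝ} (hx : x ∈ S.I) {n : ℕ} (hn : 1 ≤ n) :
    (S.f i)^[n] x ∈ S.f i '' S.I := by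
  obtain ⟨k, rfl⟩ : ∃ k, n = k + 1 := ⟨n - 1, by omega⟩
  rw [Function.iterate_succ_apply']
  exact ⟨_, S.iterI hi hx k, rfl⟩

theorem exR (S : ClassE) : ∃ R : ℝ, 0 ≤ R ∧ R < 1 ∧ ∀ i, S.Vd i → S.r i ≤ R := by
  have hne : (Finset.Icc 1 S.m).Nonempty := ⟨1, Finset.mem_Icc.2 ⟨le_rfl, by have := S.hm; omega⟩⟩
  obtain ⟨i, hi, h⟩ := Finset.exists_max_image (Finset.Icc 1 S.m) S.r hne
  have hi' := Finset.mem_Icc.1 hi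
  have := S.hr i hi'.1 hi'.2
  exact ⟨S.r i, this.1.le, this.2, fun j hj => h j (Finset.mem_Icc.2 hj)⟩

theorem pm_diff (S : ClassE) {R : ℝ} (hR0 : 0 ≤ R) (hR : ∀ i, S.Vd i → S.r i ≤ R) (d : ℕ → ℕ)
    (hd : ∀ n, S.Vd (d n)) (n : ℕ) (x y : ℝ) :
    |S.prefixMap d n x - S.prefixMap d n y| ≤ R ^ n * |x - y| := by
  induction n generalizing x y with
  | zero => simp [prefixMap]
  | succ n ih =>
    simp only [prefixMap, Function.comp]
    refine (ih _ _).trans ?_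
    have h1 : S.f (d n) x - S.f (d n) y = S.r (d n) * (x - y) := by simp only [f]; ring
    have h0 := (S.hr _ (hd n).1 (hd n).2).1
    rw [h1, abs_mul, abs_of_pos h0, pow_succ, mul_assoc]
    have := hR _ (hd n)
    gcongr

theorem coding_of (S : ClassE) (d : ℕ → ℕ) (hd : ∀ n, S.Vd (d n)) (x : ℝ)
    (h : ∀ n, ∃ z ∈ S.I, S.prefixMap d n z = x) : d ∈ S.codings x := by
  refine ⟨hd, ?_⟩
  obtain ⟨R, hR0, hR1, hR⟩ := S.exR
  rw [tendsto_iff_dist_tendsto_zero]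
  have ht : Tendsto (fun n : ℕ => R ^ n * (|S.a| + |S.b|)) atTop (nhds 0) := by
    simpa using (tendsto_pow_atTop_nhds_zero_of_lt_one hR0 hR1).mul_const (|S.a| + |S.b|)
  refine squeeze_zero (fun _ => dist_nonneg) (fun n => ?_) ht
  obtain ⟨z, hz, rfl⟩ := h n
  rw [Real.dist_eq]
  refine (S.pm_diff hR0 hR d hd n 0 z).trans ?_
  refine mul_le_mul_of_nonneg_left ?_ (pow_nonneg hR0 n)
  rw [zero_sub, abs_neg]
  obtain ⟨h1, h2⟩ := hz
  rw [abs_le]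
  constructor
  · have := neg_abs_le S.a; have := abs_nonneg S.b; linarith
  · have := le_abs_self S.b; have := abs_nonneg S.a; linarith

theorem pmE (S : ClassE) (d : ℕ → ℕ) (hd : ∀ n, S.Vd (d n)) (n : ℕ) {x : ℝ} (hx : x ∈ S.E) :
    S.prefixMap d n x ∈ S.E := by
  induction n generalizing x with
  | zero => exact hx
  | succ n ih => exact ih (S.fE (hd n) hx)

theorem coding_E (S : ClassE) {d : ℕ → ℕ} {x : ℝ} (h : d ∈ S.codings x) : x ∈ S.E := by
  obtain ⟨hd, ht⟩ := h
  obtain ⟨R, hR0, hR1, hR⟩ := S.exR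
  have ht2 : Tendsto (fun n => S.prefixMap d n S.a - S.prefixMap d n 0) atTop (nhds 0) := by
    have ht : Tendsto (fun n : ℕ => R ^ n * |S.a - 0|) atTop (nhds 0) := by
      simpa using (tendsto_pow_atTop_nhds_zero_of_lt_one hR0 hR1).mul_const (|S.a - 0|)
    exact squeeze_zero_norm (fun n => S.pm_diff hR0 hR d hd n _ _) ht
  have ht3 := ht2.add ht
  simp only [sub_add_cancel, zero_add] at ht3
  exact S.hEcpt.isClosed.mem_of_tendsto ht3 (Eventually.of_forall fun n => S.pmE d hd n S.aE)

theorem pm_cns (S : ClassE) (i : ℕ) (d : ℕ → ℕ) (n : ℕ) (x : ℝ) :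
    S.prefixMap (cns i d) (n + 1) x = S.f i (S.prefixMap d n x) := by
  induction n generalizing x with
  | zero => rfl
  | succ n ih =>
    show S.prefixMap (cns i d) (n + 1) (S.f (d n) x) = _
    rw [ih]; rfl

theorem cns_mem (S : ClassE) {i : ℕ} (hi : S.Vd i) {d : ℕ → ℕ} {y : ℝ} :
    cns i d ∈ S.codings (S.f i y) ↔ d ∈ S.codings y := by
  have h0 := (S.hr i hi.1 hi.2).1
  constructor
  · rintro ⟨h1, h2⟩
    refine ⟨fun n => h1 (n + 1), ?_⟩
    have h3 := (tendsto_add_atTop_iff_nat 1).2 h2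
    simp only [pm_cns] at h3
    have h4 := (h3.sub_const (S.t i)).const_mul (S.r i)⁻¹
    simp only [f, add_sub_cancel_right] at h4
    simpa [← mul_assoc, inv_mul_cancel₀ h0.ne'] using h4
  · rintro ⟨h1, h2⟩
    refine ⟨fun n => by cases n with | zero => exact hi | succ n => exact h1 n, ?_⟩
    refine (tendsto_add_atTop_iff_nat 1).1 ?_
    simp only [pm_cns]
    simp only [f]
    exact (h2.const_mul _).add_const _

theorem coding_cases (S : ClassE) {d : ℕ → ℕ} {x : ℝ} (h : d ∈ S.codings x) :
    ∃ i c y, S.Vd i ∧ c ∈ S.codings y ∧ S.f i y = x ∧ d = cns i c := by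
  have hi : S.Vd (d 0) := h.1 0
  have h0 := (S.hr _ hi.1 hi.2).1
  have hx : S.f (d 0) ((x - S.t (d 0)) / S.r (d 0)) = x := by
    simp only [f]; field_simp; ring
  refine ⟨d 0, fun n => d (n + 1), (x - S.t (d 0)) / S.r (d 0), hi, ?_, hx, (cns_eta d).symm⟩
  rw [← S.cns_mem hi, cns_eta, hx]
  exact h

theorem ex_coding (S : ClassE) {x : ℝ} (hx : x ∈ S.E) : (S.codings x).Nonempty := by
  have : ∀ z : S.E, ∃ p : ℕ × S.E, S.Vd p.1 ∧ S.f p.1 p.2 = z := by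
    rintro ⟨z, hz⟩
    obtain ⟨i, y, hi, hy, h⟩ := S.Epre hz
    exact ⟨(i, ⟨y, hy⟩), hi, h⟩
  choose g hg1 hg2 using this
  let T : ℕ → S.E := fun n => (fun z => (g z).2)^[n] ⟨x, hx⟩
  refine ⟨fun n => (g (T n)).1, S.coding_of _ (fun n => hg1 _) x fun n => ⟨T n, S.EI (T n).2, ?_⟩⟩
  induction n with
  | zero => rfl
  | succ n ih =>
    have : T (n + 1) = (g (T n)).2 := Function.iterate_succ_apply' _ _ _
    simp only [prefixMap, Function.comp]
    rw [this, hg2, ih]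

theorem coding_pre (S : ClassE) {d : ℕ → ℕ} {x : ℝ} (h : d ∈ S.codings x) (n : ℕ) :
    ∃ z, S.prefixMap d n z = x ∧ (fun k => d (n + k)) ∈ S.codings z := by
  induction n with
  | zero => exact ⟨x, rfl, by simpa using h⟩
  | succ n ih =>
    obtain ⟨z, hz, hc⟩ := ih
    obtain ⟨i, c, y, hi, hcy, hf, he⟩ := S.coding_cases hc
    have hi' : d n = i := by have := congrFun he 0; simpa [cns] using this
    refine ⟨y, ?_, ?_⟩
    · simp only [prefixMap, Function.comp]; rw [hi', hf, hz]
    · have : (fun k => d (n + 1 + k)) = c := by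
        funext k
        have := congrFun he (k + 1)
        simp only [cns] at this
        rw [← this]; congr 1; ring
      rw [this]; exact hcy

theorem pm_congr (S : ClassE) {d d' : ℕ → ℕ} (n : ℕ) (h : ∀ k < n, d k = d' k) :
    S.prefixMap d n = S.prefixMap d' n := by
  induction n with
  | zero => rfl
  | succ n ih =>
    simp only [prefixMap]
    rw [ih (fun k hk => h k (by omega)), h n (by omega)]

theorem cod_closed (S : ClassE) (x : ℝ) : IsClosed (S.codings x) := by
  rw [← isSeqClosed_iff_isClosed]
  intro s d hs hd
  have key : ∀ n, ∃ N, ∀ k < n, s N k = d k := by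
    intro n
    have : ∀ᶠ N in atTop, ∀ k ∈ Finset.range n, s N k = d k := by
      rw [Filter.eventually_all_finset]
      intro k _
      have := (tendsto_pi_nhds.1 hd) k
      rw [nhds_discrete, tendsto_pure] at this
      exact this
    obtain ⟨N, hN⟩ := this.exists
    exact ⟨N, fun k hk => hN k (Finset.mem_range.2 hk)⟩
  refine S.coding_of d (fun n => ?_) x fun n => ?_
  · obtain ⟨N, hN⟩ := key (n + 1)
    rw [← hN n (by omega)]
    exact (hs N).1 n
  · obtain ⟨N, hN⟩ := key n
    obtain ⟨z, hz, hc⟩ := S.coding_pre (hs N) n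
    exact ⟨z, S.EI (S.coding_E hc), by rw [← S.pm_congr n hN]; exact hz⟩

/-- number of codings -/
noncomputable def N (S : ClassE) (x : ℝ) : Cardinal := Cardinal.mk (S.codings x)

theorem cod_single (S : ClassE) {i : ℕ} (hi : S.Vd i) {y : ℝ}
    (h : ∀ j, S.Vd j → j ≠ i → S.f i y ∉ S.f j '' S.I) :
    S.codings (S.f i y) = cns i '' S.codings y := by
  ext d
  constructor
  · intro hd
    obtain ⟨j, c, z, hj, hc, hf, rfl⟩ := S.coding_cases hd
    by_cases hji : j = i
    · subst hji
      rw [S.f_inj hj hf] at hc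
      exact ⟨c, hc, rfl⟩
    · exact absurd ⟨z, S.EI (S.coding_E hc), hf⟩ (h j hj hji)
  · rintro ⟨c, hc, rfl⟩
    exact (S.cns_mem hi).2 hc

theorem N_single (S : ClassE) {i : ℕ} (hi : S.Vd i) {y : ℝ}
    (h : ∀ j, S.Vd j → j ≠ i → S.f i y ∉ S.f j '' S.I) : S.N (S.f i y) = S.N y := by
  rw [N, N, S.cod_single hi h]
  exact Cardinal.mk_image_eq (cns_inj i)

theorem cod_double (S : ClassE) {i j : ℕ} (hi : S.Vd i) (hj : S.Vd j) {y z : ℝ}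
    (hyz : S.f i y = S.f j z)
    (h : ∀ k, S.Vd k → k ≠ i → k ≠ j → S.f i y ∉ S.f k '' S.I) :
    S.codings (S.f i y) = cns i '' S.codings y ∪ cns j '' S.codings z := by
  ext d
  constructor
  · intro hd
    obtain ⟨k, c, w, hk, hc, hf, rfl⟩ := S.coding_cases hd
    by_cases hki : k = i
    · subst hki
      rw [S.f_inj hk hf] at hc
      exact Or.inl ⟨c, hc, rfl⟩
    by_cases hkj : k = j
    · subst hkj
      rw [hyz] at hf
      rw [S.f_inj hk hf] at hc
      exact Or.inr ⟨c, hc, rfl⟩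
    · exact absurd ⟨w, S.EI (S.coding_E hc), hf⟩ (h k hk hki hkj)
  · rintro (⟨c, hc, rfl⟩ | ⟨c, hc, rfl⟩)
    · exact (S.cns_mem hi).2 hc
    · rw [hyz]; exact (S.cns_mem hj).2 hc

theorem N_double (S : ClassE) {i j : ℕ} (hi : S.Vd i) (hj : S.Vd j) (hij : i ≠ j) {y z : ℝ}
    (hyz : S.f i y = S.f j z)
    (h : ∀ k, S.Vd k → k ≠ i → k ≠ j → S.f i y ∉ S.f k '' S.I) :
    S.N (S.f i y) = S.N y + S.N z := by
  rw [N, N, N, S.cod_double hi hj hyz h, Cardinal.mk_union_of_disjoint,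
    Cardinal.mk_image_eq (cns_inj i), Cardinal.mk_image_eq (cns_inj j)]
  rw [Set.disjoint_left]
  rintro d ⟨c, _, rfl⟩ ⟨c', _, h'⟩
  exact hij (congrFun h' 0).symm

def Aff (g : ℝ → ℝ) : Prop := ∃ α β : ℝ, 0 < α ∧ ∀ x, g x = α * x + β

theorem Aff.comp {g h : ℝ → ℝ} (hg : Aff g) (hh : Aff h) : Aff (g ∘ h) := by
  obtain ⟨α, β, h0, h1⟩ := hg
  obtain ⟨α', β', h0', h1'⟩ := hh
  exact ⟨α * α', α * β' + β, mul_pos h0 h0', fun x => by simp only [Function.comp, h1, h1']; ring⟩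

theorem Aff.iter {g : ℝ → ℝ} (hg : Aff g) (n : ℕ) : Aff g^[n] := by
  induction n with
  | zero => exact ⟨1, 0, one_pos, fun x => by simp⟩
  | succ n ih => rw [Function.iterate_succ]; exact ih.comp hg

theorem aff_f (S : ClassE) {i : ℕ} (hi : S.Vd i) : Aff (S.f i) :=
  ⟨S.r i, S.t i, (S.hr i hi.1 hi.2).1, fun _ => rfl⟩

theorem Aff.image_sub {g h : ℝ → ℝ} (hg : Aff g) (hh : Aff h) {a b : ℝ} (hab : a ≤ b)
    (hs : g '' Icc a b ⊆ h '' Icc a b) : h a ≤ g a ∧ g b ≤ h b := by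
  obtain ⟨α, β, h0, h1⟩ := hg
  obtain ⟨α', β', h0', h1'⟩ := hh
  obtain ⟨x, hx, hx'⟩ := hs ⟨a, ⟨le_rfl, hab⟩, rfl⟩
  obtain ⟨y, hy, hy'⟩ := hs ⟨b, ⟨hab, le_rfl⟩, rfl⟩
  rw [← hx', ← hy', h1', h1', h1', h1']
  have := mul_le_mul_of_nonneg_left hx.1 h0'.le
  have := mul_le_mul_of_nonneg_left hy.2 h0'.le
  constructor <;> linarith

theorem Aff.eq {g h : ℝ → ℝ} (hg : Aff g) (hh : Aff h) {a b : ℝ} (hab : a < b)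
    (hs : g '' Icc a b = h '' Icc a b) : g = h := by
  have h1 := hg.image_sub hh hab.le hs.subset
  have h2 := hh.image_sub hg hab.le hs.symm.subset
  have ea := le_antisymm h2.1 h1.1
  have eb := le_antisymm h1.2 h2.2
  obtain ⟨α, β, h0, h1⟩ := hg
  obtain ⟨α', β', h0', h1'⟩ := hh
  rw [h1, h1'] at ea eb
  have : α * (b - a) = α' * (b - a) := by linarith
  have hα : α = α' := mul_right_cancel₀ (sub_pos.2 hab).ne' this
  subst hα
  funext x
  rw [h1, h1']; linarith

theorem a_lt_b (S : ClassE) (hS : S.goodE) : S.a < S.b := by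
  obtain ⟨⟨_, _, h, _⟩, _⟩ := hS
  have hm := S.hm
  have := (S.hr S.m (by omega) le_rfl).1
  simp only [f] at h
  nlinarith

theorem a_mono (S : ClassE) (hS : S.goodE) {i j : ℕ} (hi : 1 ≤ i) (hij : i ≤ j) (hj : j ≤ S.m) :
    S.f i S.a ≤ S.f j S.a := by
  induction j, hij using Nat.le_induction with
  | base => exact le_rfl
  | succ j hij ih => exact (ih (by omega)).trans (hS.1.2.1 j (by omega) (by omega)).le

theorem img_le (S : ClassE) {i : ℕ} (hi : S.Vd i) {x : ℝ} (hx : x ∈ S.f i '' S.I) :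
    S.f i S.a ≤ x ∧ x ≤ S.f i S.b := by
  obtain ⟨y, ⟨h1, h2⟩, rfl⟩ := hx
  have h3 := (S.hr i hi.1 hi.2).1
  have h4 := mul_le_mul_of_nonneg_left h1 h3.le
  have h5 := mul_le_mul_of_nonneg_left h2 h3.le
  simp only [f] at *
  constructor <;> linarith

theorem img_of_le (S : ClassE) {i : ℕ} (hi : S.Vd i) {x : ℝ} (h1 : S.f i S.a ≤ x)
    (h2 : x ≤ S.f i S.b) : x ∈ S.f i '' S.I := by
  have h3 := (S.hr i hi.1 hi.2).1
  simp only [f] at *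
  refine ⟨(x - S.t i) / S.r i, ⟨?_, ?_⟩, ?_⟩
  · rw [le_div_iff₀ h3]; linarith
  · rw [div_le_iff₀ h3]; linarith
  · simp only [f]; field_simp; ring

theorem far (S : ClassE) (hS : S.goodE) {i j : ℕ} (hi : 1 ≤ i) (hij : i + 2 ≤ j) (hj : j ≤ S.m)
    {x : ℝ} (h1 : x ∈ S.f i '' S.I) (h2 : x ∈ S.f j '' S.I) : False := by
  have hvi : S.Vd i := ⟨hi, by omega⟩
  have hvk : S.Vd (i + 2) := ⟨by omega, by omega⟩
  have e1 := (S.img_le hvi h1).2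
  have e2 := (S.img_le (i := j) ⟨by omega, hj⟩ h2).1
  have e3 := S.a_mono hS (by omega) hij hj
  have e4 := S.a_mono hS hi (show i ≤ i + 2 by omega) (by omega)
  have hab := (S.a_lt_b hS).le
  have : S.f (i + 2) S.a ∈ S.f i '' S.I ∩ S.f (i + 2) '' S.I :=
    ⟨S.img_of_le hvi e4 (by linarith), ⟨S.a, ⟨le_rfl, hab⟩, rfl⟩⟩
  rw [hS.2.1 i hi (by omega)] at this
  exact this

theorem ovl (S : ClassE) (hS : S.goodE) {i : ℕ} (hi : 1 ≤ i) (him : i + 1 ≤ S.m)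
    (hne : S.f i '' S.I ∩ S.f (i + 1) '' S.I ≠ ∅) :
    ∃ u v : ℕ, 1 ≤ u ∧ 1 ≤ v ∧ (∀ x, S.f i ((S.f S.m)^[u] x) = S.f (i + 1) ((S.f 1)^[v] x)) ∧
      ∀ x, x ∈ S.f i '' S.I → x ∈ S.f (i + 1) '' S.I → ∃ z ∈ S.I, x = S.f i ((S.f S.m)^[u] z) := by
  obtain ⟨u, v, hu, hv, h1, h2⟩ := hS.2.2.2 i hi him hne
  have hm := S.hm
  refine ⟨u, v, hu, hv, ?_, ?_⟩
  · have e := h1.symm.trans h2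
    have A1 := (S.aff_f (i := i) ⟨hi, by omega⟩).comp
      ((S.aff_f (i := S.m) ⟨by omega, le_rfl⟩).iter u)
    have A2 := (S.aff_f (i := i + 1) ⟨by omega, him⟩).comp
      ((S.aff_f (i := 1) ⟨le_rfl, by omega⟩).iter v)
    exact fun x => congrFun (A1.eq A2 (S.a_lt_b hS) e) x
  · intro x hx1 hx2
    have : x ∈ S.f i '' S.I ∩ S.f (i + 1) '' S.I := ⟨hx1, hx2⟩
    rw [h1] at this
    obtain ⟨z, hz, rfl⟩ := this
    exact ⟨z, hz, rfl⟩

theorem over_mem (S : ClassE) (hS : S.goodE) {i : ℕ} (hi : 1 ≤ i) (him : i + 1 ≤ S.m) {y : ℝ} :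
    (S.f i y ∈ S.f i '' S.I → S.f i y ∈ S.f (i + 1) '' S.I → y ∈ S.f S.m '' S.I) ∧
    (S.f (i + 1) y ∈ S.f i '' S.I → S.f (i + 1) y ∈ S.f (i + 1) '' S.I → y ∈ S.f 1 '' S.I) := by
  have hm := S.hm
  constructor
  · intro h1 h2
    obtain ⟨u, v, hu, hv, e, hh⟩ := S.ovl hS hi him (Set.Nonempty.ne_empty ⟨_, h1, h2⟩)
    obtain ⟨z, hz, hx⟩ := hh _ h1 h2
    rw [S.f_inj (i := i) ⟨hi, by omega⟩ hx]
    exact S.iter_mem ⟨by omega, le_rfl⟩ hz hu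
  · intro h1 h2
    obtain ⟨u, v, hu, hv, e, hh⟩ := S.ovl hS hi him (Set.Nonempty.ne_empty ⟨_, h1, h2⟩)
    obtain ⟨z, hz, hx⟩ := hh _ h1 h2
    rw [e] at hx
    rw [S.f_inj (i := i + 1) ⟨by omega, him⟩ hx]
    exact S.iter_mem ⟨by omega, by omega⟩ hz hv

/-- one-sided data -/
structure Side (S : ClassE) (p q e u v : ℕ) (w : ℝ) : Prop where
  hp : S.Vd p
  hq : S.Vd q
  he : S.Vd e
  hpq : p ≠ q
  hu : 1 ≤ u
  hv : 1 ≤ v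
  eqn : ∀ x, S.f p ((S.f e)^[u] x) = S.f q ((S.f p)^[v] x)
  h2 : ∀ z ∈ S.I, ∀ j, S.Vd j → j ≠ p → S.f p z ∈ S.f j '' S.I → j = q ∧ z ∈ S.f e '' S.I
  h3 : ∀ x, x ∈ S.f p '' S.I → x ∈ S.f e '' S.I → False
  h4 : ∀ z ∈ S.I, ∀ j, S.Vd j → j ≠ e → S.f e z ∈ S.f j '' S.I → z ∈ S.f p '' S.I
  hw : w ∈ S.E
  fw : S.f e w = w

theorem Side.iter_p {S : ClassE} {p q e u v : ℕ} {w : ℝ} (H : S.Side p q e u v w) {z : ℝ}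
    (hz : z ∈ S.I) (k : ℕ) :
    S.codings ((S.f p)^[k + 1] z) = (cns p)^[k] '' S.codings (S.f p z) := by
  induction k with
  | zero => simp
  | succ k ih =>
    rw [Function.iterate_succ_apply', S.cod_single H.hp, ih, ← image_comp,
      Function.iterate_succ']
    intro j hj hjp hm
    exact H.h3 _ (S.iter_mem H.hp hz (by omega)) (H.h2 _ (S.iterI H.hp hz _) j hj hjp hm).2

theorem Side.cod {S : ClassE} {p q e u v : ℕ} {w : ℝ} (H : S.Side p q e u v w) {z : ℝ}
    (hz : z ∈ S.I) :
    S.codings (S.f p ((S.f e)^[u] z)) = cns p '' S.codings ((S.f e)^[u] z) ∪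
      cns q '' ((cns p)^[v - 1] '' S.codings (S.f p z)) ∧
    S.N (S.f p ((S.f e)^[u] z)) = S.N ((S.f e)^[u] z) + S.N (S.f p z) := by
  have hh : ∀ k, S.Vd k → k ≠ p → k ≠ q → S.f p ((S.f e)^[u] z) ∉ S.f k '' S.I :=
    fun k hk hkp hkq hm => hkq (H.h2 _ (S.iterI H.he hz _) k hk hkp hm).1
  have hi := H.iter_p hz (v - 1)
  rw [Nat.sub_add_cancel H.hv] at hi
  refine ⟨?_, ?_⟩
  · rw [S.cod_double H.hp H.hq (H.eqn z) hh, hi]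
  · rw [S.N_double H.hp H.hq H.hpq (H.eqn z) hh]
    congr 1
    rw [N, N, hi]
    exact Cardinal.mk_image_eq ((cns_inj p).iterate _)

theorem Side.w_mem {S : ClassE} {p q e u v : ℕ} {w : ℝ} (H : S.Side p q e u v w) :
    w ∈ S.f e '' S.I := ⟨w, S.EI H.hw, H.fw⟩

theorem Side.w_not {S : ClassE} {p q e u v : ℕ} {w : ℝ} (H : S.Side p q e u v w) :
    w ∉ S.f p '' S.I := fun h => H.h3 _ h H.w_mem

theorem Side.cod_w {S : ClassE} {p q e u v : ℕ} {w : ℝ} (H : S.Side p q e u v w) :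
    S.codings w = {fun _ => e} := by
  have h1 : S.codings w = cns e '' S.codings w := by
    have := S.cod_single H.he (y := w) (fun j hj hje hm => H.w_not (H.h4 _ (S.EI H.hw) j hj hje hm))
    rwa [H.fw] at this
  have h2 : ∀ n, ∀ d ∈ S.codings w, d n = e := by
    intro n
    induction n with
    | zero => intro d hd; rw [h1] at hd; obtain ⟨c, hc, rfl⟩ := hd; rfl
    | succ n ih => intro d hd; rw [h1] at hd; obtain ⟨c, hc, rfl⟩ := hd; exact ih c hc
  exact Set.eq_singleton_iff_nonempty_unique_mem.2 ⟨S.ex_coding H.hw, fun d hd => funext fun n => h2 n d hd⟩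

theorem Side.N_w {S : ClassE} {p q e u v : ℕ} {w : ℝ} (H : S.Side p q e u v w) :
    S.N w = 1 := by rw [N, H.cod_w]; simp

theorem Side.iter_w {S : ClassE} {p q e u v : ℕ} {w : ℝ} (H : S.Side p q e u v w) (n : ℕ) :
    (S.f e)^[n] w = w := Function.iterate_fixed H.fw n

theorem contr (p q k : ℕ) {c d : ℕ → ℕ} {n : ℕ} (h : ∀ i < n, c i = d i) :
    ∀ i < n + 1, cns q ((cns p)^[k] c) i = cns q ((cns p)^[k] d) i := by
  have h1 : ∀ (c d : ℕ → ℕ), (∀ i < n, c i = d i) → ∀ i < n, cns p c i = cns p d i := by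
    intro c d h i hi
    cases i with
    | zero => rfl
    | succ i => exact h i (by omega)
  have h2 : ∀ i < n, (cns p)^[k] c i = (cns p)^[k] d i := by
    induction k with
    | zero => exact h
    | succ k ih => rw [Function.iterate_succ_apply', Function.iterate_succ_apply']; exact h1 _ _ ih
  intro i hi
  cases i with
  | zero => rfl
  | succ i => exact h2 i (by omega)

theorem countable_of {C : Set (ℕ → ℕ)} {s : ℕ → ℕ} {G : (ℕ → ℕ) → (ℕ → ℕ)}
    (hG : ∀ n c d, (∀ i < n, c i = d i) → ∀ i < n + 1, G c i = G d i)
    (hC : C ⊆ {s} ∪ G '' C) : C.Countable := by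
  have h1 : ∀ n, ∀ d ∈ C, (∃ k, d = G^[k] s) ∨ d ∈ range G^[n] := by
    intro n
    induction n with
    | zero => intro d _; right; simp
    | succ n ih =>
      intro d hd
      rcases hC hd with h | ⟨c, hc, rfl⟩
      · left; exact ⟨0, h⟩
      · rcases ih c hc with ⟨k, rfl⟩ | ⟨y, rfl⟩
        · left; exact ⟨k + 1, by rw [Function.iterate_succ_apply']⟩
        · right; exact ⟨y, by rw [Function.iterate_succ_apply']⟩
  have h2 : ∀ n c d, ∀ i < n, G^[n] c i = G^[n] d i := by
    intro n c d
    induction n with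
    | zero => intro i hi; omega
    | succ n ih =>
      rw [Function.iterate_succ_apply', Function.iterate_succ_apply']; exact hG n _ _ ih
  have h3 : (⋂ n, range G^[n]).Subsingleton := by
    intro c hc d hd
    funext i
    simp only [mem_iInter] at hc hd
    obtain ⟨c', rfl⟩ := hc (i + 1)
    obtain ⟨d', hd'⟩ := hd (i + 1)
    rw [← hd']
    exact h2 (i + 1) c' d' i (by omega)
  refine ((Set.countable_range (fun k => G^[k] s)).union h3.countable).mono ?_
  intro d hd
  by_cases hk : ∃ k, d = G^[k] s
  · obtain ⟨k, rfl⟩ := hk; left; exact ⟨k, rfl⟩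
  · right; rw [mem_iInter]; intro n; exact (h1 n d hd).resolve_left hk

theorem Side.aleph {S : ClassE} {p q e u v : ℕ} {w : ℝ} (H : S.Side p q e u v w) :
    S.f p w ∈ S.U Cardinal.aleph0 := by
  refine ⟨S.fE H.hp H.hw, ?_⟩
  have h := H.cod (S.EI H.hw)
  rw [H.iter_w, H.N_w, H.cod_w] at h
  obtain ⟨h1, h2⟩ := h
  apply le_antisymm
  · rw [Cardinal.mk_le_aleph0_iff]
    refine (countable_of (s := cns p (fun _ => e)) (G := fun c => cns q ((cns p)^[v - 1] c))
      (fun n c d => contr p q (v - 1)) ?_)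
    nth_rewrite 1 [h1]
    rw [image_image, image_singleton]
  · change Cardinal.aleph0 ≤ S.N (S.f p w)
    by_contra hlt
    rw [not_le, Cardinal.lt_aleph0] at hlt
    obtain ⟨n, hn⟩ := hlt
    rw [hn] at h2
    have : n = 1 + n := by exact_mod_cast h2
    omega

theorem Side.three {S : ClassE} {p q e u v : ℕ} {w : ℝ} (H : S.Side p q e u v w) {i : ℕ}
    (hi : S.Vd i) (hip : p ≠ i) (hie : e ≠ i)
    (hj : ∀ j, S.Vd j → j ≠ i → S.f i w ∉ S.f j '' S.I) : (S.U (3 : ℕ)).Nonempty := by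
  have hwI := S.EI H.hw
  set y := S.f i w with hy
  have hyE : y ∈ S.E := S.fE hi H.hw
  have hyI : y ∈ S.I := S.EI hyE
  have hNy : S.N y = 1 := by rw [hy, S.N_single hi hj, H.N_w]
  have hyp : y ∉ S.f p '' S.I := hj p H.hp hip
  have hye : y ∉ S.f e '' S.I := hj e H.he hie
  have hit : ∀ k, S.N ((S.f e)^[k] y) = 1 := by
    intro k
    induction k with
    | zero => exact hNy
    | succ k ih =>
      rw [Function.iterate_succ_apply', S.N_single H.he, ih]
      intro j hj hje hm
      have h5 := H.h4 _ (S.iterI H.he hyI k) j hj hje hm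
      rcases Nat.eq_zero_or_pos k with rfl | hk
      · exact hyp h5
      · exact H.h3 _ h5 (S.iter_mem H.he hyI hk)
  have h0 : S.N (S.f p y) = 1 := by
    rw [S.N_single H.hp, hNy]
    intro j hj hjp hm
    exact hye (H.h2 _ hyI j hj hjp hm).2
  have h1 := (H.cod hyI).2
  have h2 := (H.cod (S.iterI H.he hyI u)).2
  rw [h1, ← Function.iterate_add_apply, hit, hit, h0] at h2
  refine ⟨_, S.fE H.hp (S.iterE H.he hyE (u + u)), h2.trans ?_⟩
  norm_num

theorem sideL (S : ClassE) (hS : S.goodE) (h : S.f 1 '' S.I ∩ S.f 2 '' S.I ≠ ∅) :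
    ∃ u v, S.Side 1 2 S.m u v S.b := by
  have hm := S.hm
  obtain ⟨u, v, hu, hv, eqn, ho⟩ := S.ovl hS le_rfl (by omega) h
  refine ⟨u, v, ⟨⟨le_rfl, by omega⟩, ⟨by omega, by omega⟩, ⟨by omega, le_rfl⟩, by omega, hu, hv, eqn,
    ?_, ?_, ?_, S.bE, hS.1.2.2.2⟩⟩
  · intro z hz j hj hj1 hm'
    have hj2 : j = 2 := by
      by_contra hne
      exact S.far hS le_rfl (by have := hj.1; omega) hj.2 ⟨z, hz, rfl⟩ hm'
    subst hj2
    exact ⟨rfl, (S.over_mem hS le_rfl (by omega)).1 ⟨z, hz, rfl⟩ hm'⟩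
  · intro x h1 h2
    exact S.far hS le_rfl (by omega) le_rfl h1 h2
  · intro z hz j hj hje hm'
    have hj2 : j + 1 = S.m := by
      by_contra hne
      exact S.far hS hj.1 (by have := hj.2; omega) le_rfl hm' ⟨z, hz, rfl⟩
    have := (S.over_mem hS hj.1 hj2.le (y := z)).2
    rw [hj2] at this
    exact this hm' ⟨z, hz, rfl⟩

theorem sideR (S : ClassE) (hS : S.goodE) (h : S.f (S.m - 1) '' S.I ∩ S.f S.m '' S.I ≠ ∅) :
    ∃ u v, S.Side S.m (S.m - 1) 1 u v S.a := by
  have hm := S.hm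
  have hm1 : S.m - 1 + 1 = S.m := by omega
  have h' : S.f (S.m - 1) '' S.I ∩ S.f (S.m - 1 + 1) '' S.I ≠ ∅ := by rwa [hm1]
  obtain ⟨u, v, hu, hv, eqn, ho⟩ := S.ovl hS (by omega) (by omega) h'
  rw [hm1] at eqn
  refine ⟨v, u, ⟨⟨by omega, le_rfl⟩, ⟨by omega, by omega⟩, ⟨le_rfl, by omega⟩, by omega, hv, hu,
    fun x => (eqn x).symm, ?_, ?_, ?_, S.aE, hS.1.1⟩⟩
  · intro z hz j hj hje hm'
    have hj2 : j + 1 = S.m := by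
      by_contra hne
      exact S.far hS hj.1 (by have := hj.2; omega) le_rfl hm' ⟨z, hz, rfl⟩
    have := (S.over_mem hS hj.1 hj2.le (y := z)).2
    rw [hj2] at this
    exact ⟨by omega, this hm' ⟨z, hz, rfl⟩⟩
  · intro x h1 h2
    exact S.far hS le_rfl (by omega) le_rfl h2 h1
  · intro z hz j hj hj1 hm'
    have hj2 : j = 2 := by
      by_contra hne
      exact S.far hS le_rfl (by have := hj.1; omega) hj.2 ⟨z, hz, rfl⟩ hm'
    subst hj2
    exact (S.over_mem hS le_rfl (by omega)).1 ⟨z, hz, rfl⟩ hm'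

theorem threeL (S : ClassE) (hS : S.goodE) (h : S.f 1 '' S.I ∩ S.f 2 '' S.I ≠ ∅) :
    (S.U (3 : ℕ)).Nonempty := by
  have hm := S.hm
  obtain ⟨u, v, H⟩ := S.sideL hS h
  obtain ⟨⟨i, hi, him, hg⟩, _⟩ := hS.2.2.1
  have hi1 : i ≠ 1 := by rintro rfl; exact h hg
  refine H.three (i := i) ⟨hi, by omega⟩ (by omega) (by omega) ?_
  intro j hj hji hmem
  have hself : S.f i S.b ∈ S.f i '' S.I := ⟨S.b, S.EI S.bE, rfl⟩
  have hj1 := hj.1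
  have hj2 := hj.2
  rcases lt_or_gt_of_ne hji with hlt | hgt
  · have : j + 1 = i := by
      by_contra hne
      exact S.far hS hj.1 (by omega) (by omega) hmem hself
    subst this
    exact H.w_not ((S.over_mem hS hj.1 (by omega)).2 hmem hself)
  · have : j = i + 1 := by
      by_contra hne
      exact S.far hS hi (by omega) hj.2 hself hmem
    subst this
    exact (Set.Nonempty.ne_empty (s := S.f i '' S.I ∩ S.f (i + 1) '' S.I) ⟨_, hself, hmem⟩) hg

theorem threeR (S : ClassE) (hS : S.goodE) (h : S.f (S.m - 1) '' S.I ∩ S.f S.m '' S.I ≠ ∅) :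
    (S.U (3 : ℕ)).Nonempty := by
  have hm := S.hm
  obtain ⟨u, v, H⟩ := S.sideR hS h
  obtain ⟨⟨i, hi, him, hg⟩, _⟩ := hS.2.2.1
  have hi1 : i + 1 ≠ S.m := by
    intro he
    have : i = S.m - 1 := by omega
    rw [he, this] at hg
    exact h hg
  refine H.three (i := i + 1) ⟨by omega, by omega⟩ (by omega) (by omega) ?_
  intro j hj hji hmem
  have hself : S.f (i + 1) S.a ∈ S.f (i + 1) '' S.I := ⟨S.a, S.EI S.aE, rfl⟩
  have hj1 := hj.1
  have hj2 := hj.2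
  rcases lt_or_gt_of_ne hji with hlt | hgt
  · have : j = i := by
      by_contra hne
      exact S.far hS hj.1 (by omega) (by omega) hmem hself
    subst this
    exact (Set.Nonempty.ne_empty (s := S.f j '' S.I ∩ S.f (j + 1) '' S.I) ⟨_, hmem, hself⟩) hg
  · have : j = i + 1 + 1 := by
      by_contra hne
      exact S.far hS (by omega) (by omega) hj.2 hself hmem
    subst this
    exact H.w_not ((S.over_mem hS (by omega) (by omega)).1 hself hmem)

def Iso (S : ClassE) (e : ℕ) : Prop :=
  ∀ j, S.Vd j → j ≠ e → ∀ x, x ∈ S.f e '' S.I → x ∉ S.f j '' S.I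

theorem iso_one (S : ClassE) (hS : S.goodE) (h : S.f 1 '' S.I ∩ S.f 2 '' S.I = ∅) : S.Iso 1 := by
  intro j hj hj1 x hx hx'
  by_cases hj2 : j = 2
  · subst hj2
    exact Set.Nonempty.ne_empty (s := S.f 1 '' S.I ∩ S.f 2 '' S.I) ⟨x, hx, hx'⟩ h
  · exact S.far hS le_rfl (by have := hj.1; omega) hj.2 hx hx'

theorem iso_m (S : ClassE) (hS : S.goodE) (h : S.f (S.m - 1) '' S.I ∩ S.f S.m '' S.I = ∅) :
    S.Iso S.m := by
  intro j hj hj1 x hx hx'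
  by_cases hj2 : j = S.m - 1
  · subst hj2
    exact Set.Nonempty.ne_empty (s := S.f (S.m - 1) '' S.I ∩ S.f S.m '' S.I) ⟨x, hx', hx⟩ h
  · exact S.far hS hj.1 (by have := hj.2; omega) le_rfl hx' hx

theorem Iso.iter {S : ClassE} {e : ℕ} (H : S.Iso e) (he : S.Vd e) {y : ℝ} (hy : y ∈ S.I) (k : ℕ) :
    S.N ((S.f e)^[k] y) = S.N y := by
  induction k with
  | zero => rfl
  | succ k ih =>
    rw [Function.iterate_succ_apply', S.N_single he, ih]
    intro j hj hje
    exact H j hj hje _ ⟨_, S.iterI he hy k, rfl⟩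

theorem dbl (S : ClassE) (hS : S.goodE) (H1 : S.Iso 1) (Hm : S.Iso S.m) {i u v : ℕ} (hi : 1 ≤ i)
    (him : i + 1 ≤ S.m) (eqn : ∀ x, S.f i ((S.f S.m)^[u] x) = S.f (i + 1) ((S.f 1)^[v] x))
    {y : ℝ} (hy : y ∈ S.I) : S.N (S.f i ((S.f S.m)^[u] y)) = 2 * S.N y := by
  have hm := S.hm
  have v1 : S.Vd 1 := ⟨le_rfl, by omega⟩
  have vm : S.Vd S.m := ⟨by omega, le_rfl⟩
  rw [S.N_double (i := i) (j := i + 1) ⟨hi, by omega⟩ ⟨by omega, him⟩ (by omega) (eqn y), H1.iter v1 hy,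
    Hm.iter vm hy, two_mul]
  intro k hk hki hki' hmem
  rcases lt_or_gt_of_ne hki with hlt | hgt
  · rw [eqn] at hmem
    exact S.far hS hk.1 (by omega) him hmem ⟨_, S.iterI v1 hy v, rfl⟩
  · exact S.far hS hi (by omega) hk.2 ⟨_, S.iterI vm hy u, rfl⟩ hmem

theorem step (S : ClassE) (hS : S.goodE) (H1 : S.Iso 1) (Hm : S.Iso S.m) {i : ℕ} (hi : S.Vd i)
    {y : ℝ} (hy : y ∈ S.I) :
    S.codings (S.f i y) = cns i '' S.codings y ∨ S.N (S.f i y) = 2 * S.N y := by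
  have hm := S.hm
  have v1 : S.Vd 1 := ⟨le_rfl, by omega⟩
  have vm : S.Vd S.m := ⟨by omega, le_rfl⟩
  by_cases h : ∀ j, S.Vd j → j ≠ i → S.f i y ∉ S.f j '' S.I
  · exact Or.inl (S.cod_single hi h)
  right
  push Not at h
  obtain ⟨j, hj, hji, hmem⟩ := h
  have hself : S.f i y ∈ S.f i '' S.I := ⟨y, hy, rfl⟩
  have h1 := hi.1
  have h2 := hi.2
  have h3 := hj.1
  have h4 := hj.2
  rcases lt_or_gt_of_ne hji with hlt | hgt
  · have : i = j + 1 := by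
      by_contra hne
      exact S.far hS hj.1 (by omega) hi.2 hmem hself
    subst this
    obtain ⟨u, v, hu, hv, eqn, hh⟩ := S.ovl hS hj.1 hi.2 (Set.Nonempty.ne_empty ⟨_, hmem, hself⟩)
    obtain ⟨z, hz, hx⟩ := hh _ hmem hself
    have hyz : y = (S.f 1)^[v] z := by
      rw [eqn] at hx; exact S.f_inj hi hx
    rw [hx, S.dbl hS H1 Hm hj.1 hi.2 eqn hz, hyz, H1.iter v1 hz]
  · have : j = i + 1 := by
      by_contra hne
      exact S.far hS hi.1 (by omega) hj.2 hself hmem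
    subst this
    obtain ⟨u, v, hu, hv, eqn, hh⟩ := S.ovl hS hi.1 hj.2 (Set.Nonempty.ne_empty ⟨_, hself, hmem⟩)
    obtain ⟨z, hz, hx⟩ := hh _ hself hmem
    have hyz : y = (S.f S.m)^[u] z := S.f_inj hi hx
    rw [hx, S.dbl hS H1 Hm hi.1 hj.2 eqn hz, hyz, Hm.iter vm hz]

def W (S : ClassE) : List ℕ → ℝ → ℝ
  | [] => id
  | i :: l => S.f i ∘ S.W l

theorem lipW (S : ClassE) (l : List ℕ) : ∃ K, LipschitzWith K (S.W l) := by
  induction l with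
  | nil => exact ⟨1, LipschitzWith.id⟩
  | cons i l ih =>
    obtain ⟨K, hK⟩ := ih
    refine ⟨_, LipschitzWith.comp (Kf := ‖S.r i‖₊) ?_ hK⟩
    refine LipschitzWith.of_dist_le_mul fun x y => ?_
    simp only [f, Real.dist_eq, coe_nnnorm, Real.norm_eq_abs]
    rw [← abs_mul]
    apply le_of_eq
    congr 1; ring

theorem split (S : ClassE) (hS : S.goodE) (H1 : S.Iso 1) (Hm : S.Iso S.m) (n : ℕ) :
    ∀ x, ∀ d ∈ S.codings x, ∀ d' ∈ S.codings x, d n ≠ d' n →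
      ∃ w, ∃ y ∈ S.E, x = S.W w y ∧ S.N x = 2 * S.N y := by
  induction n with
  | zero =>
    intro x d hd d' hd' hne
    obtain ⟨i, c, y, hi, hc, rfl, rfl⟩ := S.coding_cases hd
    rcases S.step hS H1 Hm hi (S.EI (S.coding_E hc)) with h | h
    · rw [h] at hd'
      obtain ⟨c', _, rfl⟩ := hd'
      exact absurd rfl hne
    · exact ⟨[i], y, S.coding_E hc, rfl, h⟩
  | succ n ih =>
    intro x d hd d' hd' hne
    obtain ⟨i, c, y, hi, hc, rfl, rfl⟩ := S.coding_cases hd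
    rcases S.step hS H1 Hm hi (S.EI (S.coding_E hc)) with h | h
    · have hd2 := hd'
      rw [h] at hd2
      obtain ⟨c', hc', rfl⟩ := hd2
      obtain ⟨w, z, hz, hx, hN⟩ := ih y c hc c' hc' hne
      refine ⟨i :: w, z, hz, by rw [hx]; rfl, ?_⟩
      rw [← hN, N, N, h]
      exact Cardinal.mk_image_eq (cns_inj i)
    · exact ⟨[i], y, S.coding_E hc, rfl, h⟩

theorem split' (S : ClassE) (hS : S.goodE) (H1 : S.Iso 1) (Hm : S.Iso S.m) {x : ℝ}
    (hx : x ∈ S.E) (h1 : S.N x ≠ 1) :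
    ∃ w, ∃ y ∈ S.E, x = S.W w y ∧ S.N x = 2 * S.N y := by
  obtain ⟨d, hd⟩ := S.ex_coding hx
  by_cases h : ∀ d' ∈ S.codings x, d' = d
  · exfalso
    apply h1
    rw [N, Set.eq_singleton_iff_unique_mem.2 ⟨hd, h⟩]
    simp
  · push Not at h
    obtain ⟨d', hd', hne⟩ := h
    obtain ⟨n, hn⟩ := Function.ne_iff.1 hne
    exact S.split hS H1 Hm n x d' hd' d hd hn

theorem half {c : Cardinal} {n : ℕ} (h : (n : Cardinal) = 2 * c) :
    ∃ k : ℕ, c = k ∧ n = 2 * k := by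
  have : c < Cardinal.aleph0 := by
    refine lt_of_le_of_lt ?_ (Cardinal.natCast_lt_aleph0 (n := n))
    rw [h, two_mul]
    exact self_le_add_left c c
  obtain ⟨k, rfl⟩ := Cardinal.lt_aleph0.1 this
  exact ⟨k, rfl, by exact_mod_cast h⟩

theorem pow_two (S : ClassE) (hS : S.goodE) (H1 : S.Iso 1) (Hm : S.Iso S.m) (n : ℕ) (hn : 1 ≤ n) :
    ∀ x ∈ S.E, S.N x = n → ∃ s, n = 2 ^ s := by
  induction n using Nat.strong_induction_on with
  | _ n ih =>
    intro x hx hN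
    by_cases h1 : n = 1
    · exact ⟨0, h1⟩
    obtain ⟨w, y, hy, -, h⟩ := S.split' hS H1 Hm hx (by rw [hN]; exact_mod_cast h1)
    rw [hN] at h
    obtain ⟨k, hk, rfl⟩ := half h
    obtain ⟨s, rfl⟩ := ih k (by omega) (by omega) y hy hk
    exact ⟨s + 1, by ring⟩

theorem dim_eq (S : ClassE) (hS : S.goodE) (H1 : S.Iso 1) (Hm : S.Iso S.m) (s : ℕ) :
    dimH (S.U ((2 ^ s : ℕ) : Cardinal)) = dimH (S.U 1) := by
  induction s with
  | zero => simp
  | succ s ih =>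
    rw [← ih]
    apply le_antisymm
    · have hsub : S.U ((2 ^ (s + 1) : ℕ) : Cardinal) ⊆
          ⋃ w : List ℕ, S.W w '' S.U ((2 ^ s : ℕ) : Cardinal) := by
        rintro x ⟨hx, hN⟩
        change S.N x = _ at hN
        have hne : S.N x ≠ 1 := by
          rw [hN]
          have : 2 ^ (s + 1) ≠ 1 := by
            rw [pow_succ]; omega
          exact_mod_cast this
        obtain ⟨w, y, hy, rfl, h⟩ := S.split' hS H1 Hm hx hne
        rw [hN] at h
        obtain ⟨k, hk, hk'⟩ := half h
        have : k = 2 ^ s := by rw [pow_succ] at hk'; omega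
        subst this
        exact mem_iUnion.2 ⟨w, y, ⟨hy, hk⟩, rfl⟩
      refine (dimH_mono hsub).trans ?_
      rw [dimH_iUnion]
      refine iSup_le fun w => ?_
      obtain ⟨K, hK⟩ := S.lipW w
      exact hK.dimH_image_le _
    · obtain ⟨_, ⟨j, hj, hjm, hne⟩⟩ := hS.2.2.1
      obtain ⟨u, v, hu, hv, eqn, -⟩ := S.ovl hS hj hjm hne
      have hm := S.hm
      have vj : S.Vd j := ⟨hj, by omega⟩
      have vm : S.Vd S.m := ⟨by omega, le_rfl⟩
      obtain ⟨α, β, hα, hg⟩ := (S.aff_f vj).comp ((S.aff_f vm).iter u)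
      have hanti : AntilipschitzWith ‖α⁻¹‖₊ (S.f j ∘ (S.f S.m)^[u]) := by
        refine AntilipschitzWith.of_le_mul_dist fun x y => ?_
        rw [hg, hg, Real.dist_eq, Real.dist_eq, coe_nnnorm, Real.norm_eq_abs, ← abs_mul]
        apply le_of_eq
        congr 1
        field_simp
        ring
      refine (hanti.le_dimH_image _).trans (dimH_mono ?_)
      rintro _ ⟨y, ⟨hy, hN⟩, rfl⟩
      refine ⟨S.fE vj (S.iterE vm hy u), ?_⟩
      change S.N _ = _
      change S.N _ = _ at hN
      rw [Function.comp, S.dbl hS H1 Hm hj hjm eqn (S.EI hy), hN, pow_succ]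
      push_cast
      ring

theorem inf_step (S : ClassE) (hS : S.goodE) (H1 : S.Iso 1) (Hm : S.Iso S.m) (n : ℕ) :
    ∀ x, ∀ d ∈ S.codings x, (S.codings x).Infinite →
      ∃ d' ∈ S.codings x, d' ≠ d ∧ ∀ k < n, d' k = d k := by
  induction n with
  | zero =>
    intro x d hd hinf
    obtain ⟨d', hd', hne⟩ := hinf.exists_notMem_finset {d}
    exact ⟨d', hd', by simpa using hne, fun k hk => by omega⟩
  | succ n ih =>
    intro x d hd hinf
    obtain ⟨i, c, y, hi, hc, rfl, rfl⟩ := S.coding_cases hd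
    have hy : (S.codings y).Infinite := by
      rcases S.step hS H1 Hm hi (S.EI (S.coding_E hc)) with h | h
      · rw [h] at hinf
        exact hinf.of_image _
      · intro hfin
        apply hinf
        rw [← Set.finite_coe_iff, ← Cardinal.lt_aleph0_iff_finite]
        change S.N _ < _
        rw [h]
        refine Cardinal.mul_lt_aleph0 (Cardinal.natCast_lt_aleph0 (n := 2)) ?_
        exact Cardinal.lt_aleph0_iff_finite.2 hfin
    obtain ⟨c', hc', hne, hk⟩ := ih y c hc hy
    refine ⟨cns i c', (S.cns_mem hi).2 hc', fun h => hne (cns_inj i h), fun k hk' => ?_⟩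
    cases k with
    | zero => rfl
    | succ k => exact hk k (by omega)

theorem no_aleph (S : ClassE) (hS : S.goodE) (H1 : S.Iso 1) (Hm : S.Iso S.m) :
    S.U Cardinal.aleph0 = ∅ := by
  rw [Set.eq_empty_iff_forall_notMem]
  rintro x ⟨hx, hN⟩
  have hinf : (S.codings x).Infinite := by
    rw [← Set.infinite_coe_iff, Cardinal.infinite_iff, hN]
  have hcount : (S.codings x).Countable := Cardinal.mk_le_aleph0_iff.1 hN.le
  have hperf : Perfect (S.codings x) := by
    refine ⟨S.cod_closed x, fun d hd => ?_⟩
    rw [accPt_iff_nhds]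
    intro V hV
    have hb : ∃ n, PiNat.cylinder d n ⊆ V := by
      obtain ⟨O, hOV, hO, hdO⟩ := mem_nhds_iff.1 hV
      obtain ⟨s, ⟨y, n, rfl⟩, hds, hs⟩ :=
        (PiNat.isTopologicalBasis_cylinders (fun _ : ℕ => ℕ)).exists_subset_of_mem_open hdO hO
      refine ⟨n, ?_⟩
      rw [PiNat.mem_cylinder_iff_eq.1 hds]
      exact hs.trans hOV
    obtain ⟨n, hn⟩ := hb
    obtain ⟨d', hd', hne, hk⟩ := S.inf_step hS H1 Hm n x d hd hinf
    exact ⟨d', ⟨hn fun k hk' => hk k hk', hd'⟩, hne⟩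
  letI := TopologicalSpace.upgradeIsCompletelyMetrizable (ℕ → ℕ)
  obtain ⟨g, hg, -, hinj⟩ := hperf.exists_nat_bool_injection (S.ex_coding hx)
  have hc : (range g).Countable := hcount.mono hg
  rw [← Set.image_univ] at hc
  have := Set.countable_of_injective_of_countable_image hinj.injOn hc
  rw [Set.countable_univ_iff] at this
  have h2 := Cardinal.mk_le_aleph0_iff.2 this
  simp only [Cardinal.mk_pi, Cardinal.mk_bool, Cardinal.prod_const, Cardinal.lift_id,
    Cardinal.mk_nat] at h2
  simp at h2
  exact absurd h2 (not_le.2 Cardinal.aleph0_lt_continuum)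

end ClassE

theorem stmt1 (S : ClassE) (hS : S.goodE) :
    List.TFAE
      [ (S.f 1 '' S.I ∩ S.f 2 '' S.I = ∅ ∧ S.f (S.m - 1) '' S.I ∩ S.f S.m '' S.I = ∅),
        (∀ k : ℕ, 1 ≤ k →
          ((∃ s : ℕ, k = 2 ^ s) → dimH (S.U k) = dimH (S.U 1)) ∧
          (¬ (∃ s : ℕ, k = 2 ^ s) → S.U k = ∅)),
        (S.f 1 S.b ∉ S.U Cardinal.aleph0 ∧ S.f S.m S.a ∉ S.U Cardinal.aleph0),
        (S.U Cardinal.aleph0 = ∅) ] := by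
  tfae_have 1 → 2 := by
    rintro ⟨h1, h2⟩ k hk
    have H1 := S.iso_one hS h1
    have Hm := S.iso_m hS h2
    refine ⟨?_, fun hn => ?_⟩
    · rintro ⟨s, rfl⟩
      exact S.dim_eq hS H1 Hm s
    · rw [Set.eq_empty_iff_forall_notMem]
      rintro x ⟨hx, hN⟩
      exact hn (S.pow_two hS H1 Hm k hk x hx hN)
  tfae_have 1 → 4 := by
    rintro ⟨h1, h2⟩
    exact S.no_aleph hS (S.iso_one hS h1) (S.iso_m hS h2)
  tfae_have 4 → 3 := by
    intro h
    rw [h]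
    exact ⟨fun h => h, fun h => h⟩
  tfae_have 3 → 1 := by
    rintro ⟨h1, h2⟩
    constructor
    · by_contra h
      obtain ⟨u, v, H⟩ := S.sideL hS h
      exact h1 H.aleph
    · by_contra h
      obtain ⟨u, v, H⟩ := S.sideR hS h
      exact h2 H.aleph
  tfae_have 2 → 1 := by
    intro h
    have h3 : S.U (3 : ℕ) = ∅ := by
      refine (h 3 (by omega)).2 ?_
      rintro ⟨s, hs⟩
      rcases s with _ | _ | s
      · omega
      · omega
      · rw [pow_succ] at hs; omega
    constructor
    · by_contra hc
      exact (S.threeL hS hc).ne_empty h3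
    · by_contra hc
      exact (S.threeR hS hc).ne_empty h3
  tfae_finish
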